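/- Assume U : cl(Λ)×cl(Λ) → [0,∞) is symmetric and continuous. Then for every ε > ε_g the limit s_I(ε) := lim_{N→∞} (1/N)·ln ∫_{Λ^N} ( 1 − I_N(q)/(εN²) )₊^{3N/2−1} λ^⊗N(dq) exists and is finite, and the function ε ↦ s_I(ε) is continuous and nondecreasing on (ε_g, ∞). -/

import Mathlib

open MeasureTheory Real Filter Set
open scoped BigOperators ENNReal

noncomputable section

abbrev Euc : Type := EuclideanSpace ℝ (Fin 3)

/-- The `N`-fold product of the normalized Lebesgue measure `λ` on `Λ`
(realized as the normalized restriction of Lebesgue measure to `Λ^N`). -/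
def piNormLeb (Λ : Set Euc) (N : ℕ) : Measure (Fin N → Euc) :=
  ((volume Λ) ^ N)⁻¹ • volume.restrict (Set.univ.pi fun _ => Λ)

/-- Interaction energy `I_N(q) = ∑_{i<j} U(q_i, q_j)`. -/
def interaction (U : Euc → Euc → ℝ) (N : ℕ) (q : Fin N → Euc) : ℝ :=
  ∑ i : Fin N, ∑ j : Fin N, if (i : ℕ) < (j : ℕ) then U (q i) (q j) else 0

/-- The bilinear pairing `⟨ρ,ρ'⟩ = ∬ ½ U(x,y) ρ(dx) ρ'(dy)`. -/
def pairing (U : Euc → Euc → ℝ) (ρ ρ' : Measure Euc) : ℝ :=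
  ∫ x, ∫ y, U x y / 2 ∂ρ' ∂ρ

/-- A Borel probability measure concentrated on `cl(Λ)`. -/
def IsProbOn (Λ : Set Euc) (ρ : Measure Euc) : Prop :=
  IsProbabilityMeasure ρ ∧ ρ ((closure Λ)ᶜ) = 0

/-- `ε_g`, the infimum of `⟨ρ,ρ⟩` over Borel probability measures on `cl(Λ)`. -/
def groundEnergy (U : Euc → Euc → ℝ) (Λ : Set Euc) : ℝ :=
  sInf { e : ℝ | ∃ ρ : Measure Euc, IsProbOn Λ ρ ∧ e = pairing U ρ ρ }


section PowerMeans

variable {Ω : Type*} [MeasurableSpace Ω] {μ : Measure Ω} {p : ℝ}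

lemma lpNorm_ofReal_eq {X : Ω → ℝ} (hX : Measurable X) (hX0 : ∀ ω, 0 ≤ X ω) (hp : 1 ≤ p) :
    lpNorm X (ENNReal.ofReal p) μ = (∫ ω, X ω ^ p ∂μ) ^ (1 / p) := by
  rw [lpNorm_eq_integral_norm_rpow_toReal (by simpa using by linarith) ENNReal.ofReal_ne_top
    hX.aestronglyMeasurable, ENNReal.toReal_ofReal (by linarith), one_div]
  simp only [Real.norm_of_nonneg (hX0 _)]

variable [IsProbabilityMeasure μ]

lemma lpNorm_le_add_const {X Y : Ω → ℝ} {d : ℝ} (hd : 0 ≤ d) (hp : 1 ≤ p)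
    (hY : MemLp Y (ENNReal.ofReal p) μ) (h : ∀ ω, ‖X ω‖ ≤ Y ω + d) :
    lpNorm X (ENNReal.ofReal p) μ ≤ lpNorm Y (ENNReal.ofReal p) μ + d := by
  have hp1 : 1 ≤ ENNReal.ofReal p := by simpa using hp
  have hc : MemLp (fun _ : Ω => d) (ENNReal.ofReal p) μ := memLp_const d
  refine (lpNorm_mono_real (hY.add hc) h).trans ((lpNorm_add_le hY hp1).trans ?_)
  rw [lpNorm_const (by positivity) (IsProbabilityMeasure.ne_zero μ)]
  simp [abs_of_nonneg hd]

lemma integrable_rpow_of_le_one {X : Ω → ℝ} (hX : Measurable X) (hX0 : ∀ ω, 0 ≤ X ω)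
    (hX1 : ∀ ω, X ω ≤ 1) (hp : 0 ≤ p) : Integrable (fun ω => X ω ^ p) μ := by
  refine Integrable.of_bound (C := 1) (hX.pow_const p).aestronglyMeasurable (ae_of_all _ fun ω => ?_)
  rw [Real.norm_of_nonneg (Real.rpow_nonneg (hX0 ω) p)]
  exact Real.rpow_le_one (hX0 ω) (hX1 ω) hp

lemma mul_measure_rpow_le_lpNorm {X : Ω → ℝ} (hX : Measurable X) (hX0 : ∀ ω, 0 ≤ X ω)
    (hX1 : ∀ ω, X ω ≤ 1) (hp : 1 ≤ p) {S : Set Ω} {a : ℝ}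
    (h : ∀ ω ∈ S, a ≤ X ω) (hS : MeasurableSet S) :
    a * μ.real S ^ (1 / p) ≤ lpNorm X (ENNReal.ofReal p) μ := by
  rcases le_or_gt a 0 with ha | ha
  · exact (mul_nonpos_of_nonpos_of_nonneg ha (by positivity)).trans lpNorm_nonneg
  have hp0 : 0 < p := by linarith
  rw [lpNorm_ofReal_eq hX hX0 hp]
  have h1 : a ^ p * μ.real S ≤ ∫ ω, X ω ^ p ∂μ := by
    have hi := integrable_rpow_of_le_one (μ := μ) hX hX0 hX1 hp0.le
    calc a ^ p * μ.real S = ∫ _ in S, a ^ p ∂μ := by simp [mul_comm]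
      _ ≤ ∫ ω in S, X ω ^ p ∂μ := by
        refine setIntegral_mono_on (integrable_const _).integrableOn hi.integrableOn hS fun ω hω => ?_
        exact Real.rpow_le_rpow ha.le (h ω hω) hp0.le
      _ ≤ _ := setIntegral_le_integral hi (ae_of_all _ fun ω => Real.rpow_nonneg (hX0 ω) p)
  calc a * μ.real S ^ (1 / p) = (a ^ p * μ.real S) ^ (1 / p) := by
        rw [Real.mul_rpow (by positivity) (by positivity), ← Real.rpow_mul ha.le,
          mul_one_div_cancel hp0.ne', Real.rpow_one]
    _ ≤ _ := Real.rpow_le_rpow (by positivity) h1 (by positivity)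

lemma exists_lpNorm_le_of_finite {J : Type*} [Fintype J] [Nonempty J] [MeasurableSpace J]
    [MeasurableSingletonClass J] {T : Ω → J} (hT : Measurable T) {φ : J → ℝ} (hφ : ∀ j, 0 ≤ φ j)
    {X : Ω → ℝ} (hX : Measurable X) (hX0 : ∀ ω, 0 ≤ X ω) (hp : 1 ≤ p)
    (h : ∀ ω, X ω ≤ φ (T ω)) :
    ∃ j, lpNorm X (ENNReal.ofReal p) μ ≤
      (Fintype.card J : ℝ) ^ (1 / p) * (φ j * μ.real (T ⁻¹' {j}) ^ (1 / p)) := by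
  have hp0 : 0 < p := by linarith
  obtain ⟨j, -, hj⟩ := Finset.exists_max_image Finset.univ
    (fun j => μ.real (T ⁻¹' {j}) * φ j ^ p) Finset.univ_nonempty
  refine ⟨j, ?_⟩
  have key : ∫ ω, X ω ^ p ∂μ ≤ Fintype.card J * (μ.real (T ⁻¹' {j}) * φ j ^ p) := by
    have hprob : IsProbabilityMeasure (μ.map T) := Measure.isProbabilityMeasure_map hT.aemeasurable
    calc ∫ ω, X ω ^ p ∂μ ≤ ∫ ω, φ (T ω) ^ p ∂μ := by
          refine integral_mono_of_nonneg (ae_of_all _ fun ω => Real.rpow_nonneg (hX0 ω) p) ?_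
            (ae_of_all _ fun ω => Real.rpow_le_rpow (hX0 ω) (h ω) hp0.le)
          exact (Integrable.of_finite (μ := μ.map T) (f := fun j => φ j ^ p)).comp_measurable hT
      _ = ∫ j, φ j ^ p ∂(μ.map T) := by
          rw [integral_map hT.aemeasurable
            (measurable_of_finite (fun j => φ j ^ p)).aestronglyMeasurable]
      _ = ∑ i, μ.real (T ⁻¹' {i}) * φ i ^ p := by
          rw [integral_fintype Integrable.of_finite]
          simp [map_measureReal_apply hT (measurableSet_singleton _)]
      _ ≤ ∑ _i : J, μ.real (T ⁻¹' {j}) * φ j ^ p := Finset.sum_le_sum fun i hi => hj i hi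
      _ = _ := by simp
  rw [lpNorm_ofReal_eq hX hX0 hp]
  calc _ ≤ (Fintype.card J * (μ.real (T ⁻¹' {j}) * φ j ^ p)) ^ (1 / p) :=
        Real.rpow_le_rpow (integral_nonneg fun ω => Real.rpow_nonneg (hX0 ω) p) key (by positivity)
    _ = _ := by
      rw [Real.mul_rpow (by positivity) (mul_nonneg (by positivity) (Real.rpow_nonneg (hφ j) p)),
        Real.mul_rpow (by positivity) (Real.rpow_nonneg (hφ j) p), ← Real.rpow_mul (hφ j),
        mul_one_div_cancel hp0.ne', Real.rpow_one, mul_comm (φ j)]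

end PowerMeans

section CellCounts

/-- The number of particles of the configuration `q` in each cell of the coarse-graining `c`. -/
def cellCount {α : Type*} {K : ℕ} (c : α → Fin K) {N : ℕ} (q : Fin N → α) (a : Fin K) : ℕ :=
  ∑ i, if c (q i) = a then 1 else 0

/-- The energy of cell occupation numbers for a coarse-grained kernel, self-energies included. -/
def cellEnergy {K : ℕ} (v : Fin K → Fin K → ℝ) (n : Fin K → ℕ) : ℝ :=
  (∑ a, ∑ b, (n a : ℝ) * n b * v a b) / 2

variable {α : Type*} {K : ℕ} {c : α → Fin K}

lemma cellCount_append {m n : ℕ} (a : Fin m → α) (b : Fin n → α) :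
    cellCount c (Fin.append a b) = cellCount c a + cellCount c b := by
  ext k
  simp only [cellCount, Fin.sum_univ_add, Fin.append_left, Fin.append_right, Pi.add_apply]

lemma cellCount_le {N : ℕ} (q : Fin N → α) (a : Fin K) : cellCount c q a ≤ N := by
  refine (Finset.sum_le_card_nsmul _ _ 1 fun i _ => ?_).trans (by simp)
  split_ifs <;> simp

lemma sum_cellCount_mul {N : ℕ} (q : Fin N → α) (f : Fin K → ℝ) :
    ∑ a, (cellCount c q a : ℝ) * f a = ∑ i, f (c (q i)) := by
  simp only [cellCount, Nat.cast_sum, Finset.sum_mul]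
  rw [Finset.sum_comm]
  simp

lemma sum_cellCount {N : ℕ} (q : Fin N → α) : ∑ a, (cellCount c q a : ℝ) = N := by
  simpa using sum_cellCount_mul (c := c) q fun _ => 1

lemma cellEnergy_cellCount {N : ℕ} (v : Fin K → Fin K → ℝ) (q : Fin N → α) :
    cellEnergy v (cellCount c q) = (∑ i, ∑ j, v (c (q i)) (c (q j))) / 2 := by
  simp only [cellEnergy, mul_assoc, ← Finset.mul_sum, sum_cellCount_mul q]

lemma cellEnergy_smul (v : Fin K → Fin K → ℝ) (m : ℕ) (n : Fin K → ℕ) :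
    cellEnergy v (m • n) = (m : ℝ) ^ 2 * cellEnergy v n := by
  simp only [cellEnergy, Pi.smul_apply, smul_eq_mul, Nat.cast_mul, mul_div_assoc', Finset.mul_sum]
  congr 1
  refine Finset.sum_congr rfl fun a _ => Finset.sum_congr rfl fun b _ => by ring

lemma cellEnergy_nonneg {v : Fin K → Fin K → ℝ} (hv : ∀ a b, 0 ≤ v a b) (n : Fin K → ℕ) :
    0 ≤ cellEnergy v n :=
  div_nonneg (Finset.sum_nonneg fun a _ => Finset.sum_nonneg fun b _ =>
    mul_nonneg (by positivity) (hv a b)) zero_le_two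

lemma cellEnergy_add_le {v : Fin K → Fin K → ℝ} {C : ℝ} (hv : ∀ a b, v a b ≤ C)
    (m n : Fin K → ℕ) :
    cellEnergy v (m + n) ≤ cellEnergy v m +
      C * ((∑ a, ((m a : ℝ) + n a)) ^ 2 - (∑ a, (m a : ℝ)) ^ 2) / 2 := by
  have h : ∑ a, ∑ b, ((m a : ℝ) + n a) * (m b + n b) * v a b ≤
      ∑ a, ∑ b, ((m a : ℝ) * m b * v a b +
        C * (((m a : ℝ) + n a) * (m b + n b) - m a * m b)) := by
    refine Finset.sum_le_sum fun a _ => Finset.sum_le_sum fun b _ => ?_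
    have : 0 ≤ ((m a : ℝ) * n b + n a * m b + n a * n b) * (C - v a b) :=
      mul_nonneg (by positivity) (sub_nonneg.2 (hv a b))
    linarith
  simp only [Finset.sum_add_distrib, ← Finset.mul_sum, Finset.sum_sub_distrib] at h
  simp only [cellEnergy, Pi.add_apply, Nat.cast_add, sq, Finset.sum_mul_sum]
  simp only [Finset.sum_add_distrib, ← Finset.mul_sum] at h ⊢
  linarith

lemma measurable_cellCount [MeasurableSpace α] (hc : Measurable c) (N : ℕ) :
    Measurable fun q : Fin N → α => cellCount c q := by
  refine measurable_pi_lambda _ fun a => Finset.measurable_sum _ fun i _ => ?_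
  exact Measurable.ite ((hc.comp (measurable_pi_apply i)) (measurableSet_singleton a))
    measurable_const measurable_const

end CellCounts

section Products

variable {α : Type*} [MeasurableSpace α] (lam : Measure α) [IsProbabilityMeasure lam]

lemma measurePreserving_append (m n : ℕ) :
    MeasurePreserving (fun p : (Fin m → α) × (Fin n → α) => Fin.append p.1 p.2)
      ((Measure.pi fun _ => lam).prod (Measure.pi fun _ => lam)) (Measure.pi fun _ => lam) := by
  have h1 := measurePreserving_sumPiEquivProdPi_symm (X := fun _ : Fin m ⊕ Fin n => α)
    (fun _ => lam)
  have h2 := measurePreserving_piCongrLeft (α := fun _ : Fin (m + n) => α) (fun _ => lam)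
    (finSumFinEquiv (m := m) (n := n))
  convert h2.comp h1 using 1
  ext p i
  refine Fin.addCases (fun i => ?_) (fun i => ?_) i
  · have := MeasurableEquiv.piCongrLeft_apply_apply (β := fun _ : Fin (m + n) => α) finSumFinEquiv
      ((MeasurableEquiv.sumPiEquivProdPi fun _ : Fin m ⊕ Fin n => α).symm p) (Sum.inl i)
    simp only [finSumFinEquiv_apply_left] at this
    simp only [Fin.append_left, Function.comp_apply, this]
    rfl
  · have := MeasurableEquiv.piCongrLeft_apply_apply (β := fun _ : Fin (m + n) => α) finSumFinEquiv
      ((MeasurableEquiv.sumPiEquivProdPi fun _ : Fin m ⊕ Fin n => α).symm p) (Sum.inr i)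
    simp only [finSumFinEquiv_apply_right] at this
    simp only [Fin.append_right, Function.comp_apply, this]
    rfl

lemma measureReal_mul_le_of_append {m n : ℕ} {A : Set (Fin m → α)} {B : Set (Fin n → α)}
    {S : Set (Fin (m + n) → α)} (hS : MeasurableSet S)
    (h : ∀ a ∈ A, ∀ b ∈ B, Fin.append a b ∈ S) :
    (Measure.pi fun _ => lam).real A * (Measure.pi fun _ => lam).real B ≤
      (Measure.pi fun _ => lam).real S := by
  rw [← measureReal_prod_prod, ← (measurePreserving_append lam m n).measureReal_preimage
    hS.nullMeasurableSet]
  exact measureReal_mono fun p hp => h p.1 hp.1 p.2 hp.2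

variable {K : ℕ} {c : α → Fin K}

lemma measureReal_cellCount_pow_le (hc : Measurable c) (M : ℕ) (n : Fin K → ℕ) (m : ℕ) :
    (Measure.pi fun _ : Fin M => lam).real {q | cellCount c q = n} ^ m ≤
      (Measure.pi fun _ : Fin (m * M) => lam).real {q | cellCount c q = m • n} := by
  have hmeas (N : ℕ) (n : Fin K → ℕ) : MeasurableSet {q : Fin N → α | cellCount c q = n} :=
    measurable_cellCount hc N (measurableSet_singleton n)
  induction m with
  | zero =>
    have : {q : Fin (0 * M) → α | cellCount c q = 0 • n} = univ := by
      ext q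
      simp only [zero_smul, mem_ofPred_eq, mem_univ, iff_true]
      ext a
      have := cellCount_le (c := c) q a
      simpa using this
    rw [this]
    simp
  | succ m ih =>
    rw [pow_succ, Nat.succ_mul]
    refine (mul_le_mul_of_nonneg_right ih measureReal_nonneg).trans ?_
    refine measureReal_mul_le_of_append lam (hmeas _ _) fun a ha b hb => ?_
    simp only [mem_ofPred_eq] at ha hb ⊢
    rw [cellCount_append, ha, hb, succ_nsmul]

lemma measureReal_cellEnergy_le (hc : Measurable c) {v : Fin K → Fin K → ℝ}
    (hv0 : ∀ a b, 0 ≤ v a b) {C : ℝ} (hC : 0 ≤ C) (hv : ∀ a b, v a b ≤ C) {M : ℕ} (hM : 0 < M)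
    (n : Fin K → ℕ) {N : ℕ} (hN : 0 < N) :
    (Measure.pi fun _ : Fin M => lam).real {q | cellCount c q = n} ^ (N / M) ≤
      (Measure.pi fun _ : Fin N => lam).real
        {q | cellEnergy v (cellCount c q) / (N : ℝ) ^ 2 ≤
          cellEnergy v n / (M : ℝ) ^ 2 + C * M / N} := by
  obtain ⟨m, r, hr, hm, rfl⟩ : ∃ m r, r < M ∧ N / M = m ∧ N = m * M + r :=
    ⟨N / M, N % M, Nat.mod_lt _ hM, rfl, by rw [mul_comm]; exact (Nat.div_add_mod N M).symm⟩
  rw [hm]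
  refine (measureReal_cellCount_pow_le lam hc M n m).trans ?_
  have huniv : (Measure.pi fun _ : Fin r => lam).real univ = 1 := by simp
  rw [← mul_one ((Measure.pi fun _ : Fin (m * M) => lam).real _), ← huniv]
  refine measureReal_mul_le_of_append lam ?_ fun a ha b _ => ?_
  · refine measurableSet_le (Measurable.div_const ?_ _) measurable_const
    exact (measurable_of_countable (cellEnergy v)).comp (measurable_cellCount hc _)
  · simp only [mem_ofPred_eq] at ha ⊢
    have h1 := cellEnergy_add_le hv (cellCount c a) (cellCount c b)
    rw [Finset.sum_add_distrib, sum_cellCount, sum_cellCount] at h1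
    rw [cellCount_append]
    rw [ha, cellEnergy_smul] at h1
    rw [ha]
    have hM' : (0 : ℝ) < M := by exact_mod_cast hM
    have hNr : (0 : ℝ) < ((m * M + r : ℕ) : ℝ) := by exact_mod_cast hN
    have hrM : (r : ℝ) ≤ M := by exact_mod_cast hr.le
    have hJ := cellEnergy_nonneg hv0 n
    push_cast at h1 hNr ⊢
    rw [div_le_iff₀ (by positivity)]
    have e1 : (m : ℝ) ^ 2 * cellEnergy v n ≤
        cellEnergy v n / (M : ℝ) ^ 2 * (m * M + r : ℝ) ^ 2 := by
      have : (m : ℝ) ^ 2 * cellEnergy v n = cellEnergy v n / (M : ℝ) ^ 2 * (m * M : ℝ) ^ 2 := by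
        field_simp
      rw [this]
      gcongr
      have : (0 : ℝ) ≤ r := by positivity
      linarith
    have e2 : C * ((m * M + r : ℝ) ^ 2 - (m * M) ^ 2) / 2 ≤
        C * M / (m * M + r) * (m * M + r : ℝ) ^ 2 := by
      have : C * M / (m * M + r) * (m * M + r : ℝ) ^ 2 = C * (M * (m * M + r)) := by
        field_simp
      rw [this, mul_div_assoc]
      refine mul_le_mul_of_nonneg_left ?_ hC
      have : 0 ≤ (m : ℝ) * M := by positivity
      have : 0 ≤ (r : ℝ) := by positivity
      nlinarith
    rw [add_mul]
    linarith

end Products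

section Core

/-- A symmetric kernel with values in `[0, C]` that is uniformly approximable by kernels which are
constant on the products of the cells of a finite measurable partition. -/
structure IsRegularKernel (U : Euc → Euc → ℝ) (C : ℝ) : Prop where
  measurable : Measurable fun p : Euc × Euc => U p.1 p.2
  symm : ∀ x y, U x y = U y x
  nonneg : ∀ x y, 0 ≤ U x y
  le : ∀ x y, U x y ≤ C
  approx : ∀ δ > 0, ∃ (K : ℕ) (c : Euc → Fin K) (v : Fin K → Fin K → ℝ), Measurable c ∧
    (∀ a b, 0 ≤ v a b) ∧ (∀ a b, v a b ≤ C) ∧ ∀ x y, |U x y - v (c x) (c y)| ≤ δ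

/-- The integrand `(1 - β I_N(q) / N²)₊`. -/
def kineticFraction (U : Euc → Euc → ℝ) (β : ℝ) (N : ℕ) (q : Fin N → Euc) : ℝ :=
  max (1 - β * (interaction U N q / (N : ℝ) ^ 2)) 0

/-- The `L^(3N/2-1)` norm of `kineticFraction`. -/
def kineticNorm (lam : Measure Euc) (U : Euc → Euc → ℝ) (β : ℝ) (N : ℕ) : ℝ :=
  lpNorm (kineticFraction U β N) (ENNReal.ofReal (3 * (N : ℝ) / 2 - 1)) (Measure.pi fun _ => lam)

variable {U : Euc → Euc → ℝ} {C : ℝ} (hU : IsRegularKernel U C)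

lemma one_le_exponent {N : ℕ} (hN : 2 ≤ N) : 1 ≤ 3 * (N : ℝ) / 2 - 1 := by
  have : (2 : ℝ) ≤ N := by exact_mod_cast hN
  linarith

lemma two_mul_interaction (hsymm : ∀ x y, U x y = U y x) (N : ℕ) (q : Fin N → Euc) :
    2 * interaction U N q = (∑ i, ∑ j, U (q i) (q j)) - ∑ i, U (q i) (q i) := by
  have h1 : interaction U N q =
      ∑ i : Fin N, ∑ j : Fin N, if (j : ℕ) < (i : ℕ) then U (q i) (q j) else 0 := by
    rw [interaction, Finset.sum_comm]
    refine Finset.sum_congr rfl fun i _ => Finset.sum_congr rfl fun j _ => ?_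
    rw [hsymm (q j)]
  have h2 : ∑ i : Fin N, U (q i) (q i) =
      ∑ i : Fin N, ∑ j : Fin N, if i = j then U (q i) (q j) else 0 := by simp
  rw [two_mul]
  nth_rewrite 2 [h1]
  rw [interaction, h2, ← Finset.sum_add_distrib, ← Finset.sum_sub_distrib]
  refine Finset.sum_congr rfl fun i _ => ?_
  rw [← Finset.sum_add_distrib, ← Finset.sum_sub_distrib]
  refine Finset.sum_congr rfl fun j _ => ?_
  rcases lt_trichotomy i j with h | h | h
  · simp [h, h.not_gt, h.ne]
  · simp [h]
  · simp [h, h.not_gt, h.ne']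

include hU

lemma IsRegularKernel.const_nonneg : 0 ≤ C := (hU.nonneg 0 0).trans (hU.le 0 0)

lemma IsRegularKernel.interaction_nonneg (N : ℕ) (q : Fin N → Euc) : 0 ≤ interaction U N q := by
  refine Finset.sum_nonneg fun i _ => Finset.sum_nonneg fun j _ => ?_
  split_ifs
  exacts [hU.nonneg _ _, le_rfl]

lemma IsRegularKernel.interaction_div_le (N : ℕ) (q : Fin N → Euc) :
    interaction U N q / (N : ℝ) ^ 2 ≤ C := by
  refine div_le_of_le_mul₀ (by positivity) hU.const_nonneg ?_
  calc interaction U N q ≤ ∑ _i : Fin N, ∑ _j : Fin N, C := by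
        refine Finset.sum_le_sum fun i _ => Finset.sum_le_sum fun j _ => ?_
        split_ifs
        exacts [hU.le _ _, hU.const_nonneg]
    _ = C * (N : ℝ) ^ 2 := by simp; ring

lemma IsRegularKernel.measurable_interaction (N : ℕ) : Measurable (interaction U N) := by
  refine Finset.measurable_sum _ fun i _ => Finset.measurable_sum _ fun j _ => ?_
  split_ifs
  · have h : Measurable fun q : Fin N → Euc => (q i, q j) :=
      (measurable_pi_apply i).prodMk (measurable_pi_apply j)
    exact hU.measurable.comp h
  · exact measurable_const

lemma IsRegularKernel.abs_interaction_sub_cellEnergy_le {δ : ℝ} {K : ℕ} {c : Euc → Fin K}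
    {v : Fin K → Fin K → ℝ} (hv : ∀ x y, |U x y - v (c x) (c y)| ≤ δ) {N : ℕ} (hN : 0 < N)
    (hCN : C ≤ δ * N) (q : Fin N → Euc) :
    |interaction U N q / (N : ℝ) ^ 2 - cellEnergy v (cellCount c q) / (N : ℝ) ^ 2| ≤ δ := by
  have hN' : (0 : ℝ) < N := by exact_mod_cast hN
  rw [← sub_div, abs_div, abs_of_pos (by positivity : (0 : ℝ) < (N : ℝ) ^ 2),
    div_le_iff₀ (by positivity)]
  have h1 := two_mul_interaction hU.symm N q
  have h2 := cellEnergy_cellCount (c := c) v q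
  have h3 : |(∑ i, ∑ j, U (q i) (q j)) - ∑ i, ∑ j, v (c (q i)) (c (q j))| ≤ δ * (N : ℝ) ^ 2 := by
    rw [← Finset.sum_sub_distrib]
    calc _ ≤ ∑ _i : Fin N, ∑ _j : Fin N, δ := by
          refine (Finset.abs_sum_le_sum_abs _ _).trans (Finset.sum_le_sum fun i _ => ?_)
          rw [← Finset.sum_sub_distrib]
          exact (Finset.abs_sum_le_sum_abs _ _).trans (Finset.sum_le_sum fun j _ => hv _ _)
      _ = _ := by simp; ring
  have h4 : 0 ≤ ∑ i, U (q i) (q i) := Finset.sum_nonneg fun i _ => hU.nonneg _ _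
  have h5 : ∑ i, U (q i) (q i) ≤ N * C := by
    simpa using Finset.sum_le_card_nsmul Finset.univ (fun i => U (q i) (q i)) C fun i _ => hU.le _ _
  have h6 : N * C ≤ δ * (N : ℝ) ^ 2 := by nlinarith
  rw [abs_le] at h3 ⊢
  constructor <;> linarith [h3.1, h3.2]

lemma IsRegularKernel.measurable_kineticFraction (β : ℝ) (N : ℕ) :
    Measurable (kineticFraction U β N) :=
  (measurable_const.sub (((hU.measurable_interaction N).div_const _).const_mul β)).max
    measurable_const

omit hU in
lemma kineticFraction_nonneg (β : ℝ) (N : ℕ) (q : Fin N → Euc) : 0 ≤ kineticFraction U β N q :=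
  le_max_right _ _

lemma IsRegularKernel.kineticFraction_le_one {β : ℝ} (hβ : 0 ≤ β) (N : ℕ) (q : Fin N → Euc) :
    kineticFraction U β N q ≤ 1 := by
  refine max_le ?_ zero_le_one
  have : 0 ≤ β * (interaction U N q / (N : ℝ) ^ 2) :=
    mul_nonneg hβ (div_nonneg (hU.interaction_nonneg N q) (by positivity))
  linarith

variable (lam : Measure Euc) [IsProbabilityMeasure lam]

lemma IsRegularKernel.memLp_kineticFraction {β : ℝ} (hβ : 0 ≤ β) (N : ℕ) (p : ℝ≥0∞) :
    MemLp (kineticFraction U β N) p (Measure.pi fun _ => lam) := by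
  refine MemLp.of_bound (hU.measurable_kineticFraction β N).aestronglyMeasurable 1
    (ae_of_all _ fun q => ?_)
  rw [Real.norm_of_nonneg (kineticFraction_nonneg β N q)]
  exact hU.kineticFraction_le_one hβ N q

lemma IsRegularKernel.kineticNorm_le_one {β : ℝ} (hβ : 0 ≤ β) {N : ℕ} (hN : 2 ≤ N) :
    kineticNorm lam U β N ≤ 1 := by
  have hp := one_le_exponent hN
  have h := lpNorm_le_add_const (μ := Measure.pi fun _ : Fin N => lam) (X := kineticFraction U β N)
    (Y := fun _ => 0) zero_le_one hp (memLp_const 0) fun q => by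
      rw [Real.norm_of_nonneg (kineticFraction_nonneg β N q), zero_add]
      exact hU.kineticFraction_le_one hβ N q
  simpa [kineticNorm] using h

lemma IsRegularKernel.kineticNorm_anti {β β' : ℝ} (hβ : 0 ≤ β) (hββ' : β ≤ β') (N : ℕ) :
    kineticNorm lam U β' N ≤ kineticNorm lam U β N := by
  refine lpNorm_mono_real (hU.memLp_kineticFraction lam hβ N _) fun q => ?_
  rw [Real.norm_of_nonneg (kineticFraction_nonneg β' N q)]
  refine max_le_max (sub_le_sub_left (mul_le_mul_of_nonneg_right hββ' ?_) _) le_rfl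
  exact div_nonneg (hU.interaction_nonneg N q) (by positivity)

lemma IsRegularKernel.kineticNorm_le_add {β β' : ℝ} (hβ : 0 ≤ β) (hββ' : β ≤ β') {N : ℕ}
    (hN : 2 ≤ N) :
    kineticNorm lam U β N ≤ kineticNorm lam U β' N + C * (β' - β) := by
  have hC := hU.const_nonneg
  refine lpNorm_le_add_const (mul_nonneg hC (sub_nonneg.2 hββ')) (one_le_exponent hN)
    (hU.memLp_kineticFraction lam (hβ.trans hββ') N _) fun q => ?_
  rw [Real.norm_of_nonneg (kineticFraction_nonneg β N q)]
  have h1 := mul_le_mul_of_nonneg_right (hU.interaction_div_le N q) (sub_nonneg.2 hββ')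
  have h2 := le_max_left (1 - β' * (interaction U N q / (N : ℝ) ^ 2)) 0
  have h3 := le_max_right (1 - β' * (interaction U N q / (N : ℝ) ^ 2)) 0
  refine max_le ?_ ?_
  · simp only [kineticFraction]
    linarith
  · exact add_nonneg h3 (mul_nonneg hC (sub_nonneg.2 hββ'))

lemma IsRegularKernel.kineticNorm_ge {δ : ℝ} {K : ℕ} {c : Euc → Fin K}
    {v : Fin K → Fin K → ℝ} (hc : Measurable c) (hv0 : ∀ a b, 0 ≤ v a b) (hvC : ∀ a b, v a b ≤ C)
    (hv : ∀ x y, |U x y - v (c x) (c y)| ≤ δ) {β : ℝ} (hβ : 0 ≤ β) {M : ℕ} (hM : 0 < M)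
    (n : Fin K → ℕ) {N : ℕ} (hN : 2 ≤ N) (hCN : C ≤ δ * N) :
    (1 - β * (cellEnergy v n / (M : ℝ) ^ 2 + δ) - β * C * M / N) *
      (Measure.pi fun _ : Fin M => lam).real {q | cellCount c q = n} ^
        ((N : ℝ) / M / (3 * (N : ℝ) / 2 - 1)) ≤ kineticNorm lam U β N := by
  set P := (Measure.pi fun _ : Fin M => lam).real {q | cellCount c q = n} with hP
  set a := 1 - β * (cellEnergy v n / (M : ℝ) ^ 2 + δ) - β * C * M / N with ha_def
  have hP0 : 0 ≤ P := measureReal_nonneg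
  have hP1 : P ≤ 1 := measureReal_le_one
  have hp := one_le_exponent hN
  have hp0 : 0 < 3 * (N : ℝ) / 2 - 1 := by linarith
  have hNpos : 0 < N := by omega
  rcases le_or_gt a 0 with ha | ha
  · exact (mul_nonpos_of_nonpos_of_nonneg ha (by positivity)).trans lpNorm_nonneg
  have hE := measureReal_cellEnergy_le lam hc hv0 hU.const_nonneg hvC hM n hNpos
  set S := {q : Fin N → Euc | cellEnergy v (cellCount c q) / (N : ℝ) ^ 2 ≤
          cellEnergy v n / (M : ℝ) ^ 2 + C * M / N} with hS
  have hSm : MeasurableSet S := by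
    refine measurableSet_le (Measurable.div_const ?_ _) measurable_const
    exact (measurable_of_countable (cellEnergy v)).comp (measurable_cellCount hc _)
  have hlow := mul_measure_rpow_le_lpNorm (μ := Measure.pi fun _ : Fin N => lam)
    (hU.measurable_kineticFraction β N) (kineticFraction_nonneg β N)
    (hU.kineticFraction_le_one hβ N) hp (S := S) (a := a) (fun q hq => by
      refine le_trans ?_ (le_max_left _ _)
      have h1 := (abs_le.1 (hU.abs_interaction_sub_cellEnergy_le hv hNpos hCN q)).2
      have h2 : cellEnergy v (cellCount c q) / (N : ℝ) ^ 2 ≤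
          cellEnergy v n / (M : ℝ) ^ 2 + C * M / N := hq
      have h3 : interaction U N q / (N : ℝ) ^ 2 ≤
          (cellEnergy v n / (M : ℝ) ^ 2 + δ) + C * M / N := by linarith
      have h4 := mul_le_mul_of_nonneg_left h3 hβ
      have h5 : β * (C * M / N) = β * C * M / N := by ring
      rw [ha_def]
      linarith) hSm
  refine le_trans (mul_le_mul_of_nonneg_left ?_ ha.le) hlow
  calc P ^ ((N : ℝ) / M / (3 * (N : ℝ) / 2 - 1)) ≤
        P ^ (((N / M : ℕ) : ℝ) * (1 / (3 * (N : ℝ) / 2 - 1))) := by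
        refine Real.rpow_le_rpow_of_exponent_ge_of_imp hP0 hP1 ?_ ?_
        · rw [mul_one_div]
          exact div_le_div_of_nonneg_right Nat.cast_div_le hp0.le
        · intro _ h0
          have : (0 : ℝ) < M := by exact_mod_cast hM
          have : (0 : ℝ) < N := by exact_mod_cast hNpos
          exact absurd h0 (by positivity)
    _ = (P ^ (N / M)) ^ (1 / (3 * (N : ℝ) / 2 - 1)) := by
        rw [Real.rpow_mul hP0, Real.rpow_natCast]
    _ ≤ _ := Real.rpow_le_rpow (by positivity) hE (by positivity)

omit hU in
lemma tendsto_div_exponent (M : ℕ) :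
    Tendsto (fun N : ℕ => (N : ℝ) / M / (3 * (N : ℝ) / 2 - 1)) atTop (nhds (2 / (3 * M))) := by
  have h : Tendsto (fun N : ℕ => 1 / M / (3 / 2 - 1 / (N : ℝ))) atTop
      (nhds (1 / M / (3 / 2 - 0))) :=
    tendsto_const_nhds.div (tendsto_const_nhds.sub tendsto_one_div_atTop_nhds_zero_nat)
      (by norm_num)
  have e : (1 / M / (3 / 2 - 0) : ℝ) = 2 / (3 * M) := by
    ring
  rw [e] at h
  refine h.congr' ?_
  filter_upwards [eventually_ge_atTop 2] with N hN
  have hN' : (2 : ℝ) ≤ N := by exact_mod_cast hN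
  have h0 : 3 / 2 - 1 / (N : ℝ) = (3 * N / 2 - 1) / N := by field_simp
  rw [h0, div_div_eq_mul_div]
  ring

lemma IsRegularKernel.eventually_kineticNorm_ge {δ : ℝ} (hδ : 0 < δ) {K : ℕ} {c : Euc → Fin K}
    {v : Fin K → Fin K → ℝ} (hc : Measurable c) (hv0 : ∀ a b, 0 ≤ v a b) (hvC : ∀ a b, v a b ≤ C)
    (hv : ∀ x y, |U x y - v (c x) (c y)| ≤ δ) {β : ℝ} (hβ : 0 ≤ β) {M : ℕ} (hM : 2 ≤ M)
    (n : Fin K → ℕ) {η : ℝ} (hη : 0 < η) :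
    ∀ᶠ N : ℕ in atTop, (1 - β * (cellEnergy v n / (M : ℝ) ^ 2 + δ)) *
      (Measure.pi fun _ : Fin M => lam).real {q | cellCount c q = n} ^
        (1 / (3 * (M : ℝ) / 2 - 1)) - η ≤ kineticNorm lam U β N := by
  have hM' : (2 : ℝ) ≤ M := by exact_mod_cast hM
  set P := (Measure.pi fun _ : Fin M => lam).real {q | cellCount c q = n} with hP
  have hP0 : 0 ≤ P := measureReal_nonneg
  have hP1 : P ≤ 1 := measureReal_le_one
  set a := 1 - β * (cellEnergy v n / (M : ℝ) ^ 2 + δ) with ha_def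
  have hpM := one_le_exponent hM
  have hpM0 : 0 < 1 / (3 * (M : ℝ) / 2 - 1) := by
    have : 0 < 3 * (M : ℝ) / 2 - 1 := by linarith
    positivity
  rcases hP0.eq_or_lt with h0 | hPpos
  · refine Eventually.of_forall fun N => ?_
    rw [← h0, Real.zero_rpow hpM0.ne']
    have : 0 ≤ kineticNorm lam U β N := lpNorm_nonneg
    linarith
  rcases le_or_gt a 0 with ha | ha
  · refine Eventually.of_forall fun N => ?_
    have h1 : 0 ≤ kineticNorm lam U β N := lpNorm_nonneg
    have h2 := mul_nonpos_of_nonpos_of_nonneg ha (Real.rpow_nonneg hP0 (1 / (3 * (M : ℝ) / 2 - 1)))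
    linarith
  have hlim : Tendsto (fun N : ℕ => (a - β * C * M / N) *
      P ^ ((N : ℝ) / M / (3 * (N : ℝ) / 2 - 1))) atTop (nhds ((a - 0) * P ^ (2 / (3 * M : ℝ)))) := by
    refine (tendsto_const_nhds.sub (tendsto_const_div_atTop_nhds_zero_nat _)).mul ?_
    exact ((Real.continuous_const_rpow hPpos.ne').tendsto _).comp (tendsto_div_exponent M)
  have hle : a * P ^ (1 / (3 * (M : ℝ) / 2 - 1)) ≤ (a - 0) * P ^ (2 / (3 * M : ℝ)) := by
    rw [sub_zero]
    refine mul_le_mul_of_nonneg_left (Real.rpow_le_rpow_of_exponent_ge hPpos hP1 ?_) ha.le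
    rw [div_le_div_iff₀ (by positivity) (by linarith)]
    linarith
  have hev := hlim.eventually_const_lt (show (a - 0) * P ^ (2 / (3 * M : ℝ)) - η < _ by linarith)
  filter_upwards [hev, eventually_ge_atTop 2, eventually_ge_atTop ⌈C / δ⌉₊] with N h1 h2 h3
  have hCN : C ≤ δ * N := by
    rw [mul_comm, ← div_le_iff₀ hδ]
    exact Nat.ceil_le.1 h3
  have := hU.kineticNorm_ge lam hc hv0 hvC hv hβ (by omega : 0 < M) n h2 hCN
  linarith

lemma IsRegularKernel.exists_kineticNorm_le {δ : ℝ} {K : ℕ} {c : Euc → Fin K}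
    {v : Fin K → Fin K → ℝ} (hc : Measurable c)
    (hv : ∀ x y, |U x y - v (c x) (c y)| ≤ δ) {β : ℝ} (hβ : 0 ≤ β) {M : ℕ} (hM : 2 ≤ M)
    (hCM : C ≤ δ * M) :
    ∃ n : Fin K → ℕ, kineticNorm lam U β M ≤
      ((M : ℝ) + 1) ^ ((K : ℝ) / (3 * (M : ℝ) / 2 - 1)) *
        (max (1 - β * (cellEnergy v n / (M : ℝ) ^ 2 - δ)) 0 *
          (Measure.pi fun _ : Fin M => lam).real {q | cellCount c q = n} ^
            (1 / (3 * (M : ℝ) / 2 - 1))) := by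
  have hT : Measurable fun (q : Fin M → Euc) (a : Fin K) =>
      (⟨cellCount c q a, Nat.lt_succ_of_le (cellCount_le q a)⟩ : Fin (M + 1)) := by
    refine measurable_pi_lambda _ fun a => ?_
    refine measurable_to_countable' fun k => ?_
    have : (fun q : Fin M → Euc =>
        (⟨cellCount c q a, Nat.lt_succ_of_le (cellCount_le q a)⟩ : Fin (M + 1))) ⁻¹' {k} =
        {q | cellCount c q a = k} := by
      ext q
      simp [Fin.ext_iff]
    rw [this]
    exact (measurable_pi_apply a).comp (measurable_cellCount hc M) (measurableSet_singleton _)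
  obtain ⟨j, hj⟩ := exists_lpNorm_le_of_finite (μ := Measure.pi fun _ : Fin M => lam) hT
    (φ := fun j => max (1 - β * (cellEnergy v (fun a => (j a : ℕ)) / (M : ℝ) ^ 2 - δ)) 0)
    (fun j => le_max_right _ _) (hU.measurable_kineticFraction β M) (kineticFraction_nonneg β M)
    (one_le_exponent hM) (fun q => by
      refine max_le_max ?_ le_rfl
      have h1 := (abs_le.1 (hU.abs_interaction_sub_cellEnergy_le hv (by omega) hCM q)).1
      refine sub_le_sub_left (mul_le_mul_of_nonneg_left ?_ hβ) _
      change cellEnergy v (cellCount c q) / (M : ℝ) ^ 2 - δ ≤ _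
      linarith)
  refine ⟨fun a => (j a : ℕ), hj.trans_eq ?_⟩
  congr 1
  · rw [Fintype.card_fun, Fintype.card_fin, Fintype.card_fin, Nat.cast_pow, ← Real.rpow_natCast,
      ← Real.rpow_mul (by positivity)]
    push_cast
    rw [mul_one_div]
  · congr 3
    ext q
    simp [funext_iff, Fin.ext_iff]

omit hU in
lemma tendsto_add_one_rpow_exponent (K : ℕ) :
    Tendsto (fun M : ℕ => ((M : ℝ) + 1) ^ ((K : ℝ) / (3 * (M : ℝ) / 2 - 1))) atTop (nhds 1) := by
  have h := tendsto_rpow_div_mul_add (K : ℝ) (3 / 2) (-(5 / 2)) (by norm_num)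
  have h2 : Tendsto (fun M : ℕ => (M : ℝ) + 1) atTop atTop :=
    tendsto_natCast_atTop_atTop.atTop_add tendsto_const_nhds
  refine (h.comp h2).congr fun M => ?_
  simp only [Function.comp_apply]
  congr 2
  ring

lemma IsRegularKernel.eventually_kineticNorm_le {β : ℝ} (hβ : 0 ≤ β) {η : ℝ} (hη : 0 < η) :
    ∀ᶠ M : ℕ in atTop, ∀ᶠ N : ℕ in atTop,
      kineticNorm lam U β M ≤ kineticNorm lam U β N + η := by
  obtain ⟨θ, hθ0, hθ1, hθη⟩ : ∃ θ : ℝ, 0 < θ ∧ θ ≤ 1 ∧ 5 * θ ≤ η :=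
    ⟨min (η / 5) 1, by positivity, min_le_right _ _, by linarith [min_le_left (η / 5) 1]⟩
  obtain ⟨δ, hδ, hδθ⟩ : ∃ δ : ℝ, 0 < δ ∧ 2 * β * δ ≤ θ := by
    refine ⟨θ / (2 * β + 1), by positivity, ?_⟩
    rw [mul_div_assoc', div_le_iff₀ (by positivity)]
    nlinarith
  obtain ⟨K, c, v, hc, hv0, hvC, hv⟩ := hU.approx δ hδ
  have hw := (tendsto_add_one_rpow_exponent K).eventually_lt_const (by linarith : (1 : ℝ) < 1 + θ)
  filter_upwards [hw, eventually_ge_atTop 2, eventually_ge_atTop ⌈C / δ⌉₊] with M hwM hM h3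
  have hCM : C ≤ δ * M := by
    rw [mul_comm, ← div_le_iff₀ hδ]
    exact Nat.ceil_le.1 h3
  obtain ⟨n, hn⟩ := hU.exists_kineticNorm_le lam hc hv hβ hM hCM
  filter_upwards [hU.eventually_kineticNorm_ge lam hδ hc hv0 hvC hv hβ hM n hθ0,
    eventually_ge_atTop 2] with N hN hN2
  have hN1 := hU.kineticNorm_le_one lam hβ hN2
  have hN0 : 0 ≤ kineticNorm lam U β N := lpNorm_nonneg
  have hpM := one_le_exponent hM
  set P := (Measure.pi fun _ : Fin M => lam).real {q | cellCount c q = n} ^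
    (1 / (3 * (M : ℝ) / 2 - 1)) with hP
  have hP0 : 0 ≤ P := Real.rpow_nonneg measureReal_nonneg _
  have hP1 : P ≤ 1 := Real.rpow_le_one measureReal_nonneg measureReal_le_one
    (one_div_nonneg.2 (by linarith))
  have hφ : max (1 - β * (cellEnergy v n / (M : ℝ) ^ 2 - δ)) 0 * P ≤
      kineticNorm lam U β N + 2 * θ := by
    rcases max_cases (1 - β * (cellEnergy v n / (M : ℝ) ^ 2 - δ)) 0 with ⟨h, -⟩ | ⟨h, -⟩
    · rw [h]
      have : 2 * β * δ * P ≤ θ * 1 := mul_le_mul hδθ hP1 hP0 hθ0.le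
      linarith
    · rw [h]
      linarith
  have hφ0 : 0 ≤ max (1 - β * (cellEnergy v n / (M : ℝ) ^ 2 - δ)) 0 * P :=
    mul_nonneg (le_max_right _ _) hP0
  calc kineticNorm lam U β M ≤ (1 + θ) * (kineticNorm lam U β N + 2 * θ) :=
        hn.trans (mul_le_mul hwM.le hφ hφ0 (by linarith))
    _ ≤ kineticNorm lam U β N + η := by nlinarith

omit hU in
lemma exists_tendsto_of_eventually_le_add {F : ℕ → ℝ} (h0 : ∀ N, 0 ≤ F N)
    (h1 : ∀ᶠ N in atTop, F N ≤ 1)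
    (h : ∀ η > 0, ∀ᶠ M in atTop, ∀ᶠ N in atTop, F M ≤ F N + η) :
    ∃ g, Tendsto F atTop (nhds g) := by
  have hb : IsBoundedUnder (· ≤ ·) atTop F := ⟨1, h1⟩
  have hb' : IsBoundedUnder (· ≥ ·) atTop F := isBoundedUnder_of ⟨0, h0⟩
  refine ⟨liminf F atTop, tendsto_of_le_liminf_of_limsup_le le_rfl ?_ hb hb'⟩
  refine le_of_forall_pos_le_add fun η hη => ?_
  refine limsup_le_of_le hb'.isCoboundedUnder_le ?_
  filter_upwards [h η hη] with M hM
  rw [← sub_le_iff_le_add]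
  refine le_liminf_of_le hb.isCoboundedUnder_ge ?_
  filter_upwards [hM] with N hN
  linarith

lemma IsRegularKernel.exists_tendsto_kineticNorm {β : ℝ} (hβ : 0 ≤ β) :
    ∃ g, Tendsto (kineticNorm lam U β) atTop (nhds g) := by
  refine exists_tendsto_of_eventually_le_add (fun N => lpNorm_nonneg) ?_
    fun η hη => hU.eventually_kineticNorm_le lam hβ hη
  filter_upwards [eventually_ge_atTop 2] with N hN
  exact hU.kineticNorm_le_one lam hβ hN

lemma IsRegularKernel.exists_pos_le_kineticNorm {β e : ℝ} (hβ : 0 ≤ β) (he : β * e < 1)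
    (hpos : ∀ᶠ M : ℕ in atTop, 0 < (Measure.pi fun _ : Fin M => lam).real
      {q | interaction U M q / (M : ℝ) ^ 2 ≤ e}) :
    ∃ a > 0, ∀ᶠ N : ℕ in atTop, a ≤ kineticNorm lam U β N := by
  obtain ⟨δ, hδ, hδe⟩ : ∃ δ : ℝ, 0 < δ ∧ 2 * β * δ < 1 - β * e := by
    refine ⟨(1 - β * e) / (2 * β + 1), div_pos (by linarith) (by positivity), ?_⟩
    rw [mul_div_assoc', div_lt_iff₀ (by positivity)]
    nlinarith
  obtain ⟨K, c, v, hc, hv0, hvC, hv⟩ := hU.approx δ hδ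
  obtain ⟨M, hM, hM2, hM3⟩ := (hpos.and ((eventually_ge_atTop 2).and
    (eventually_ge_atTop ⌈C / δ⌉₊))).exists
  have hCM : C ≤ δ * M := by
    rw [mul_comm, ← div_le_iff₀ hδ]
    exact Nat.ceil_le.1 hM3
  set μ := Measure.pi fun _ : Fin M => lam with hμ
  obtain ⟨n, hn, hnE⟩ : ∃ n : Fin K → ℕ, 0 < μ.real {q | cellCount c q = n} ∧
      cellEnergy v n / (M : ℝ) ^ 2 ≤ e + δ := by
    by_contra! hcon
    refine hM.ne' ?_
    rw [measureReal_eq_zero_iff]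
    have hsub : {q : Fin M → Euc | interaction U M q / (M : ℝ) ^ 2 ≤ e} ⊆
        ⋃ n ∈ {n : Fin K → ℕ | cellEnergy v n / (M : ℝ) ^ 2 ≤ e + δ}, {q | cellCount c q = n} := by
      intro q hq
      have h1 := (abs_le.1 (hU.abs_interaction_sub_cellEnergy_le hv (by omega) hCM q)).1
      have h2 : interaction U M q / (M : ℝ) ^ 2 ≤ e := hq
      simp only [mem_iUnion, mem_ofPred_eq, exists_prop, exists_eq_right']
      linarith
    refine measure_mono_null hsub ((measure_biUnion_null_iff (Set.to_countable _)).2 fun n hn => ?_)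
    by_contra h
    have h' : 0 < μ.real {q | cellCount c q = n} :=
      measureReal_nonneg.lt_of_ne fun h0 => h (by rwa [eq_comm, measureReal_eq_zero_iff] at h0)
    have h3 : cellEnergy v n / (M : ℝ) ^ 2 ≤ e + δ := hn
    linarith [hcon n h']
  have ha : 0 < 1 - β * (cellEnergy v n / (M : ℝ) ^ 2 + δ) := by
    have := mul_le_mul_of_nonneg_left hnE hβ
    nlinarith
  set b := (1 - β * (cellEnergy v n / (M : ℝ) ^ 2 + δ)) *
    μ.real {q | cellCount c q = n} ^ (1 / (3 * (M : ℝ) / 2 - 1)) with hb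
  have hbpos : 0 < b := mul_pos ha (Real.rpow_pos_of_pos hn _)
  refine ⟨b / 2, by positivity, ?_⟩
  filter_upwards [hU.eventually_kineticNorm_ge lam hδ hc hv0 hvC hv hβ hM2 n (half_pos hbpos)]
    with N hN
  linarith

end Core

section ConfigurationSpace

/-- The map which is the identity on `closure Λ` and sends all other points to `x₀`. -/
def closureRetract (Λ : Set Euc) (x₀ : Euc) : Euc → Euc := by
  classical exact (closure Λ).piecewise id fun _ => x₀

variable {Λ : Set Euc} {x₀ : Euc}

lemma closureRetract_mem (hx₀ : x₀ ∈ Λ) (x : Euc) : closureRetract Λ x₀ x ∈ closure Λ := by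
  classical
  by_cases h : x ∈ closure Λ
  · simp [closureRetract, h]
  · simpa [closureRetract, h] using subset_closure hx₀

lemma closureRetract_of_mem {x : Euc} (h : x ∈ closure Λ) : closureRetract Λ x₀ x = x := by
  simp [closureRetract, h]

lemma measurable_closureRetract : Measurable (closureRetract Λ x₀) := by
  classical
  exact measurable_id.piecewise isClosed_closure.measurableSet measurable_const

lemma exists_finite_partition {s : Set Euc} (hs : IsCompact s) (hne : s.Nonempty) {r : ℝ}
    (hr : 0 < r) :
    ∃ (K : ℕ) (c : Euc → Fin K) (t : Fin K → Euc), Measurable c ∧ (∀ a, t a ∈ s) ∧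
      ∀ x ∈ s, dist x (t (c x)) < r := by
  have : Nonempty s := hne.to_subtype
  let e : ℕ → Euc := fun k => (TopologicalSpace.denseSeq s k : Euc)
  obtain ⟨N, hN⟩ := hs.elim_directed_cover (fun N : ℕ => ⋃ k ∈ Set.Iic N, Metric.ball (e k) r)
    (fun N => isOpen_biUnion fun k _ => Metric.isOpen_ball)
    (fun x hx => by
      obtain ⟨k, hk⟩ := (TopologicalSpace.denseRange_denseSeq s).exists_dist_lt ⟨x, hx⟩ hr
      exact mem_iUnion.2 ⟨k, mem_biUnion (Set.self_mem_Iic) hk⟩)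
    (directed_of_isDirected_le fun m n hmn => biUnion_subset_biUnion_left (Set.Iic_subset_Iic.2 hmn))
  refine ⟨N + 1, fun x => ⟨SimpleFunc.nearestPtInd e N x,
    Nat.lt_succ_of_le (SimpleFunc.nearestPtInd_le e N x)⟩, fun a => e a, ?_,
    fun a => Subtype.coe_prop _, fun x hx => ?_⟩
  · refine measurable_to_countable' fun k => ?_
    convert (SimpleFunc.nearestPtInd e N).measurableSet_fiber (k : ℕ) using 1
    ext x
    simp [Fin.ext_iff]
  · obtain ⟨k, hk, hxk⟩ := mem_iUnion₂.1 (hN hx)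
    have h1 := SimpleFunc.edist_nearestPt_le e x (Set.mem_Iic.1 hk)
    rw [edist_dist, edist_dist, ENNReal.ofReal_le_ofReal_iff dist_nonneg] at h1
    rw [dist_comm]
    refine lt_of_le_of_lt h1 ?_
    rwa [dist_comm]

variable {U : Euc → Euc → ℝ}

lemma exists_isRegularKernel (hx₀ : x₀ ∈ Λ) (hΛbdd : Bornology.IsBounded Λ)
    (hUnonneg : ∀ x ∈ closure Λ, ∀ y ∈ closure Λ, 0 ≤ U x y)
    (hUsymm : ∀ x ∈ closure Λ, ∀ y ∈ closure Λ, U x y = U y x)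
    (hUcont : ContinuousOn (fun p : Euc × Euc => U p.1 p.2) (closure Λ ×ˢ closure Λ)) :
    ∃ C, IsRegularKernel
      (fun x y => U (closureRetract Λ x₀ x) (closureRetract Λ x₀ y)) C := by
  have hK : IsCompact (closure Λ) := hΛbdd.isCompact_closure
  have hKK := hK.prod hK
  have hr := closureRetract_mem hx₀
  obtain ⟨C, hC⟩ := hKK.bddAbove_image hUcont
  have hC' : ∀ x ∈ closure Λ, ∀ y ∈ closure Λ, U x y ≤ C := fun x hx y hy =>
    hC ⟨(x, y), ⟨hx, hy⟩, rfl⟩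
  refine ⟨C, ?_, fun x y => hUsymm _ (hr x) _ (hr y), fun x y => hUnonneg _ (hr x) _ (hr y),
    fun x y => hC' _ (hr x) _ (hr y), fun δ hδ => ?_⟩
  · classical
    have h1 := hUcont.measurable_piecewise (g := fun _ => 0) continuousOn_const
      (isClosed_closure.prod isClosed_closure).measurableSet
    have h2 : Measurable fun p : Euc × Euc => (closureRetract Λ x₀ p.1, closureRetract Λ x₀ p.2) :=
      (measurable_closureRetract.comp measurable_fst).prodMk
        (measurable_closureRetract.comp measurable_snd)
    convert h1.comp h2 using 1
    ext p
    simp [hr]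
  · have huc := Metric.uniformContinuousOn_iff.1 (hKK.uniformContinuousOn_of_continuous hUcont) δ hδ
    obtain ⟨r, hrpos, huc⟩ := huc
    obtain ⟨K, c, t, hc, ht, hct⟩ := exists_finite_partition hK ⟨_, subset_closure hx₀⟩ hrpos
    refine ⟨K, fun x => c (closureRetract Λ x₀ x), fun a b => U (t a) (t b),
      hc.comp measurable_closureRetract, fun a b => hUnonneg _ (ht a) _ (ht b),
      fun a b => hC' _ (ht a) _ (ht b), fun x y => ?_⟩
    have h := huc (closureRetract Λ x₀ x, closureRetract Λ x₀ y) ⟨hr x, hr y⟩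
      (t (c (closureRetract Λ x₀ x)), t (c (closureRetract Λ x₀ y))) ⟨ht _, ht _⟩
      (max_lt (hct _ (hr x)) (hct _ (hr y)))
    exact h.le

lemma interaction_congr_of_mem {N : ℕ} {q : Fin N → Euc} (hq : ∀ i, q i ∈ closure Λ) :
    interaction (fun x y => U (closureRetract Λ x₀ x) (closureRetract Λ x₀ y)) N q =
      interaction U N q := by
  simp only [interaction, closureRetract_of_mem (hq _)]

/-- The normalized Lebesgue measure on `Λ`. -/
def normLeb (Λ : Set Euc) : Measure Euc := (volume Λ)⁻¹ • volume.restrict Λ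

lemma isProbabilityMeasure_normLeb (hΛne : Λ.Nonempty) (hΛopen : IsOpen Λ)
    (hΛbdd : Bornology.IsBounded Λ) : IsProbabilityMeasure (normLeb Λ) := by
  refine ⟨?_⟩
  simp [normLeb, ENNReal.inv_mul_cancel (hΛopen.measure_pos volume hΛne).ne' hΛbdd.measure_lt_top.ne]

lemma piNormLeb_eq_pi (hΛne : Λ.Nonempty) (hΛopen : IsOpen Λ)
    (hΛbdd : Bornology.IsBounded Λ) (N : ℕ) :
    piNormLeb Λ N = Measure.pi fun _ : Fin N => normLeb Λ := by
  have := isProbabilityMeasure_normLeb hΛne hΛopen hΛbdd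
  symm
  refine Measure.pi_eq fun s hs => ?_
  rw [piNormLeb, Measure.smul_apply, Measure.restrict_apply (MeasurableSet.univ_pi hs),
    ← Set.pi_inter_distrib, volume_pi_pi]
  simp only [normLeb, Measure.smul_apply, Measure.restrict_apply (hs _), smul_eq_mul,
    Finset.prod_mul_distrib]
  simp [ENNReal.inv_pow]

lemma integral_pi_pair (ρ : Measure Euc) [IsProbabilityMeasure ρ] {W : Euc → Euc → ℝ} {C : ℝ}
    (hW : IsRegularKernel W C) {N : ℕ} {i j : Fin N} (hij : i ≠ j) :
    ∫ q : Fin N → Euc, W (q i) (q j) ∂(Measure.pi fun _ => ρ) = ∫ x, ∫ y, W x y ∂ρ ∂ρ := by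
  have hind : ProbabilityTheory.iIndepFun (fun (i : Fin N) (q : Fin N → Euc) => q i)
      (Measure.pi fun _ => ρ) :=
    ProbabilityTheory.iIndepFun_pi (X := fun _ => id) fun _ => aemeasurable_id
  have hmap := (ProbabilityTheory.indepFun_iff_map_prod_eq_prod_map_map
    (measurable_pi_apply i).aemeasurable (measurable_pi_apply j).aemeasurable).1
    (hind.indepFun hij)
  have hi := (measurePreserving_eval (fun _ : Fin N => ρ) i).map_eq
  have hj := (measurePreserving_eval (fun _ : Fin N => ρ) j).map_eq
  have hpair : Measurable fun q : Fin N → Euc => (q i, q j) :=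
    (measurable_pi_apply i).prodMk (measurable_pi_apply j)
  have hmap' : (Measure.pi fun _ : Fin N => ρ).map (fun q => (q i, q j)) = ρ.prod ρ := by
    rw [hmap]
    exact congrArg₂ _ hi hj
  have hintegral : Integrable (fun p : Euc × Euc => W p.1 p.2) (ρ.prod ρ) :=
    Integrable.of_bound hW.measurable.aestronglyMeasurable C (ae_of_all _ fun p => by
      rw [Real.norm_of_nonneg (hW.nonneg _ _)]
      exact hW.le _ _)
  rw [← integral_prod _ hintegral, ← hmap', integral_map hpair.aemeasurable
    hW.measurable.aestronglyMeasurable]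

lemma exists_interaction_le (ρ : Measure Euc) [IsProbabilityMeasure ρ] {W : Euc → Euc → ℝ} {C : ℝ}
    (hW : IsRegularKernel W C) (N : ℕ) :
    ∃ q : Fin N → Euc, interaction W N q ≤ pairing W ρ ρ * (N : ℝ) ^ 2 := by
  set D := ∫ x, ∫ y, W x y ∂ρ ∂ρ with hD
  have hD0 : 0 ≤ D := integral_nonneg fun x => integral_nonneg fun y => hW.nonneg x y
  have hpair : pairing W ρ ρ = D / 2 := by
    simp only [pairing, integral_div, hD]
  have hintegral : Integrable (interaction W N) (Measure.pi fun _ : Fin N => ρ) := by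
    refine Integrable.of_bound (hW.measurable_interaction N).aestronglyMeasurable (C * (N : ℝ) ^ 2)
      (ae_of_all _ fun q => ?_)
    rw [Real.norm_of_nonneg (hW.interaction_nonneg N q)]
    rcases N.eq_zero_or_pos with rfl | hN
    · simp [interaction]
    · have : (0 : ℝ) < N := by exact_mod_cast hN
      exact (div_le_iff₀ (by positivity)).1 (hW.interaction_div_le N q)
  obtain ⟨q, hq⟩ := exists_le_integral hintegral
  refine ⟨q, hq.trans ?_⟩
  have hterm (i j : Fin N) : Integrable
      (fun q : Fin N → Euc => if (i : ℕ) < j then W (q i) (q j) else 0)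
      (Measure.pi fun _ : Fin N => ρ) := by
    split_ifs
    · have h : Measurable fun q : Fin N → Euc => (q i, q j) :=
        (measurable_pi_apply i).prodMk (measurable_pi_apply j)
      refine Integrable.of_bound (hW.measurable.comp h).aestronglyMeasurable C
        (ae_of_all _ fun q => ?_)
      rw [Real.norm_of_nonneg (hW.nonneg _ _)]
      exact hW.le _ _
    · exact integrable_zero _ _ _
  have hI : ∫ q, interaction W N q ∂(Measure.pi fun _ : Fin N => ρ) =
      interaction (fun _ _ => D) N q := by
    simp only [interaction]
    rw [integral_finsetSum _ fun i _ => integrable_finsetSum _ fun j _ => hterm i j]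
    refine Finset.sum_congr rfl fun i _ => ?_
    rw [integral_finsetSum _ fun j _ => hterm i j]
    refine Finset.sum_congr rfl fun j _ => ?_
    split_ifs with h
    · exact integral_pi_pair ρ hW (Fin.ne_of_lt h)
    · simp
  have h2 := two_mul_interaction (U := fun _ _ => D) (fun _ _ => rfl) N q
  simp only [Finset.sum_const, Finset.card_univ, Fintype.card_fin, nsmul_eq_mul] at h2
  rw [hI, hpair]
  have : 0 ≤ (N : ℝ) * D := by positivity
  nlinarith

lemma groundEnergy_nonneg (hUnonneg : ∀ x ∈ closure Λ, ∀ y ∈ closure Λ, 0 ≤ U x y) :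
    0 ≤ groundEnergy U Λ := by
  refine Real.sInf_nonneg ?_
  rintro _ ⟨ρ, ⟨-, hρ⟩, rfl⟩
  have hae : ∀ᵐ x ∂ρ, x ∈ closure Λ := hρ
  refine integral_nonneg_of_ae ?_
  filter_upwards [hae] with x hx
  refine integral_nonneg_of_ae ?_
  filter_upwards [hae] with y hy
  exact div_nonneg (hUnonneg x hx y hy) zero_le_two

lemma exists_pairing_lt (hΛne : Λ.Nonempty) {ε : ℝ} (hε : groundEnergy U Λ < ε) :
    ∃ ρ : Measure Euc, IsProbOn Λ ρ ∧ pairing U ρ ρ < ε := by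
  obtain ⟨x, hx⟩ := hΛne
  have hne : { e : ℝ | ∃ ρ : Measure Euc, IsProbOn Λ ρ ∧ e = pairing U ρ ρ }.Nonempty :=
    ⟨_, Measure.dirac x, ⟨Measure.dirac.isProbabilityMeasure, by
      rw [Measure.dirac_apply' _ isClosed_closure.isOpen_compl.measurableSet]
      simp [subset_closure hx]⟩, rfl⟩
  obtain ⟨_, ⟨ρ, hρ, rfl⟩, h⟩ := exists_lt_of_csInf_lt hne hε
  exact ⟨ρ, hρ, h⟩

lemma pairing_congr_of_isProbOn {ρ : Measure Euc} (hρ : IsProbOn Λ ρ) :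
    pairing (fun x y => U (closureRetract Λ x₀ x) (closureRetract Λ x₀ y)) ρ ρ =
      pairing U ρ ρ := by
  have hae : ∀ᵐ x ∂ρ, x ∈ closure Λ := hρ.2
  refine integral_congr_ae ?_
  filter_upwards [hae] with x hx
  refine integral_congr_ae ?_
  filter_upwards [hae] with y hy
  simp only [closureRetract_of_mem hx, closureRetract_of_mem hy]

lemma piNormLeb_interaction_lt_pos (hΛopen : IsOpen Λ) (hΛbdd : Bornology.IsBounded Λ)
    (hUcont : ContinuousOn (fun p : Euc × Euc => U p.1 p.2) (closure Λ ×ˢ closure Λ)) {N : ℕ}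
    {e : ℝ} {q : Fin N → Euc} (hq : ∀ i, q i ∈ closure Λ) (he : interaction U N q < e) :
    0 < piNormLeb Λ N ({q | interaction U N q < e} ∩ Set.univ.pi fun _ => Λ) := by
  have hcl : closure (Set.univ.pi fun _ : Fin N => Λ) = Set.univ.pi fun _ => closure Λ :=
    closure_pi_set _ _
  have hcont : ContinuousOn (interaction U N) (Set.univ.pi fun _ => closure Λ) := by
    refine continuousOn_finsetSum _ fun i _ => continuousOn_finsetSum _ fun j _ => ?_
    split_ifs
    · exact hUcont.comp (f := fun q : Fin N → Euc => (q i, q j))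
        ((continuous_apply i).prodMk (continuous_apply j)).continuousOn
        fun q hq => ⟨hq i (mem_univ i), hq j (mem_univ j)⟩
    · exact continuousOn_const
  have hopen : IsOpen (Set.univ.pi fun _ : Fin N => Λ) :=
    isOpen_set_pi Set.finite_univ fun _ _ => hΛopen
  have hsub : (Set.univ.pi fun _ : Fin N => Λ) ⊆ Set.univ.pi fun _ => closure Λ :=
    Set.pi_mono fun _ _ => subset_closure
  have hqcl : q ∈ Set.univ.pi fun _ : Fin N => closure Λ := fun i _ => hq i
  have hV : IsOpen ((Set.univ.pi fun _ : Fin N => Λ) ∩ interaction U N ⁻¹' Iio e) :=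
    (hcont.mono hsub).isOpen_inter_preimage hopen isOpen_Iio
  have hne : ((Set.univ.pi fun _ : Fin N => Λ) ∩ interaction U N ⁻¹' Iio e).Nonempty := by
    have h1 : ∀ᶠ q' in nhdsWithin q (Set.univ.pi fun _ : Fin N => Λ), interaction U N q' < e :=
      ((hcont q hqcl).mono hsub).eventually_lt_const he
    have : (nhdsWithin q (Set.univ.pi fun _ : Fin N => Λ)).NeBot :=
      mem_closure_iff_nhdsWithin_neBot.1 (hcl ▸ hqcl)
    obtain ⟨q', h2, h3⟩ := (h1.and self_mem_nhdsWithin).exists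
    exact ⟨q', h3, h2⟩
  have hset : ({q | interaction U N q < e} ∩ Set.univ.pi fun _ => Λ) =
      (Set.univ.pi fun _ : Fin N => Λ) ∩ interaction U N ⁻¹' Iio e := by
    rw [Set.inter_comm]
    rfl
  rw [hset, piNormLeb, Measure.smul_apply, Measure.restrict_apply hV.measurableSet,
    Set.inter_eq_left.2 Set.inter_subset_left, smul_eq_mul]
  exact ENNReal.mul_pos (ENNReal.inv_ne_zero.2 (ENNReal.pow_ne_top hΛbdd.measure_lt_top.ne))
    (hV.measure_pos volume hne).ne'

lemma log_integral_eq_log_kineticNorm (hΛne : Λ.Nonempty) (hΛopen : IsOpen Λ)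
    (hΛbdd : Bornology.IsBounded Λ) {C : ℝ}
    (hW : IsRegularKernel (fun x y => U (closureRetract Λ x₀ x) (closureRetract Λ x₀ y)) C)
    (ε : ℝ) {N : ℕ} (hN : 2 ≤ N)
    (hpos : 0 < kineticNorm (normLeb Λ)
      (fun x y => U (closureRetract Λ x₀ x) (closureRetract Λ x₀ y)) ε⁻¹ N) :
    (1 / (N : ℝ)) * Real.log (∫ q : Fin N → Euc,
      (max (1 - interaction U N q / (ε * (N : ℝ) ^ 2)) 0) ^ ((3 * (N : ℝ)) / 2 - 1)
        ∂(piNormLeb Λ N)) =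
    (3 / 2 - 1 / (N : ℝ)) * Real.log (kineticNorm (normLeb Λ)
      (fun x y => U (closureRetract Λ x₀ x) (closureRetract Λ x₀ y)) ε⁻¹ N) := by
  have hN0 : (N : ℝ) ≠ 0 := by positivity
  have hp := one_le_exponent hN
  have hp0 : 3 * (N : ℝ) / 2 - 1 ≠ 0 := by linarith
  set W := fun x y => U (closureRetract Λ x₀ x) (closureRetract Λ x₀ y) with hWdef
  have hintegral : ∫ q : Fin N → Euc,
      (max (1 - interaction U N q / (ε * (N : ℝ) ^ 2)) 0) ^ ((3 * (N : ℝ)) / 2 - 1)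
        ∂(piNormLeb Λ N) =
      ∫ q, kineticFraction W ε⁻¹ N q ^ (3 * (N : ℝ) / 2 - 1) ∂(piNormLeb Λ N) := by
    simp only [piNormLeb, integral_smul_measure]
    congr 1
    refine setIntegral_congr_fun (MeasurableSet.univ_pi fun _ => hΛopen.measurableSet) fun q hq => ?_
    have hq' : ∀ i, q i ∈ closure Λ := fun i => subset_closure (hq i (mem_univ i))
    simp only [kineticFraction, hWdef, interaction_congr_of_mem hq']
    congr 3
    ring
  rw [hintegral, piNormLeb_eq_pi hΛne hΛopen hΛbdd]
  have hnorm := lpNorm_ofReal_eq (μ := Measure.pi fun _ : Fin N => normLeb Λ)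
    (hW.measurable_kineticFraction ε⁻¹ N) (kineticFraction_nonneg ε⁻¹ N) hp
  set A := ∫ q, kineticFraction W ε⁻¹ N q ^ (3 * (N : ℝ) / 2 - 1)
    ∂(Measure.pi fun _ : Fin N => normLeb Λ) with hA
  have hA0 : 0 ≤ A := integral_nonneg fun q => Real.rpow_nonneg (kineticFraction_nonneg _ _ _) _
  change kineticNorm (normLeb Λ) W ε⁻¹ N = _ at hnorm
  rw [hnorm] at hpos ⊢
  have hApos : 0 < A := by
    refine hA0.lt_of_ne fun h0 => ?_
    rw [← h0, Real.zero_rpow (one_div_ne_zero hp0)] at hpos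
    exact hpos.false
  have h3 : 3 / 2 - 1 / (N : ℝ) = (3 * N / 2 - 1) / N := by field_simp
  rw [Real.log_rpow hApos, h3, ← mul_assoc, div_mul_div_cancel₀' hp0]

end ConfigurationSpace

theorem statement7
    (Λ : Set Euc) (hΛne : Λ.Nonempty) (hΛopen : IsOpen Λ)
    (hΛbdd : Bornology.IsBounded Λ) (hΛconn : IsConnected Λ)
    (U : Euc → Euc → ℝ)
    (hUnonneg : ∀ x ∈ closure Λ, ∀ y ∈ closure Λ, 0 ≤ U x y)
    (hUsymm : ∀ x ∈ closure Λ, ∀ y ∈ closure Λ, U x y = U y x)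
    (hUcont : ContinuousOn (fun p : Euc × Euc => U p.1 p.2) (closure Λ ×ˢ closure Λ)) :
    ∃ sI : ℝ → ℝ,
      (∀ ε : ℝ, groundEnergy U Λ < ε →
        Tendsto (fun N : ℕ =>
            (1 / (N : ℝ)) *
              Real.log (∫ q : Fin N → Euc,
                (max (1 - interaction U N q / (ε * (N : ℝ) ^ 2)) 0)
                    ^ ((3 * (N : ℝ)) / 2 - 1)
                  ∂(piNormLeb Λ N)))
          atTop (nhds (sI ε))) ∧
      ContinuousOn sI (Ioi (groundEnergy U Λ)) ∧
      MonotoneOn sI (Ioi (groundEnergy U Λ)) := by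
  have ⟨x₀, hx₀⟩ := hΛne
  obtain ⟨C, hW⟩ := exists_isRegularKernel hx₀ hΛbdd hUnonneg hUsymm hUcont
  set W : Euc → Euc → ℝ := fun x y => U (closureRetract Λ x₀ x) (closureRetract Λ x₀ y) with hWdef
  have hprob := isProbabilityMeasure_normLeb hΛne hΛopen hΛbdd
  have hge := groundEnergy_nonneg hUnonneg
  let g : ℝ → ℝ := fun β => limUnder atTop (kineticNorm (normLeb Λ) W β)
  have hg : ∀ β, 0 ≤ β → Tendsto (kineticNorm (normLeb Λ) W β) atTop (nhds (g β)) := fun β hβ =>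
    tendsto_nhds_limUnder (hW.exists_tendsto_kineticNorm (normLeb Λ) hβ)
  have hlow : ∀ ε, groundEnergy U Λ < ε →
      ∃ a > 0, ∀ᶠ N : ℕ in atTop, a ≤ kineticNorm (normLeb Λ) W ε⁻¹ N := by
    intro ε hε
    have hε0 : 0 < ε := hge.trans_lt hε
    obtain ⟨ρ, hρ, hρε⟩ := exists_pairing_lt hΛne hε
    obtain ⟨e, he1, he2⟩ := exists_between hρε
    have : IsProbabilityMeasure ρ := hρ.1
    refine hW.exists_pos_le_kineticNorm (normLeb Λ) (e := e) (by positivity)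
      (by rwa [inv_mul_lt_iff₀ hε0, mul_one]) ?_
    filter_upwards [eventually_gt_atTop 0] with M hM
    have hM' : (0 : ℝ) < M := by exact_mod_cast hM
    obtain ⟨q, hq⟩ := exists_interaction_le ρ hW M
    rw [hWdef, pairing_congr_of_isProbOn hρ] at hq
    have hq' : interaction U M (fun i => closureRetract Λ x₀ (q i)) < e * (M : ℝ) ^ 2 :=
      lt_of_le_of_lt hq (mul_lt_mul_of_pos_right he1 (by positivity))
    have hpos := piNormLeb_interaction_lt_pos hΛopen hΛbdd hUcont
      (fun i => closureRetract_mem hx₀ (q i)) hq'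
    rw [piNormLeb_eq_pi hΛne hΛopen hΛbdd] at hpos
    refine (ENNReal.toReal_pos hpos.ne' (measure_ne_top _ _)).trans_le (measureReal_mono ?_)
    rintro q' ⟨h1, h2⟩
    have hcl : ∀ i, q' i ∈ closure Λ := fun i => subset_closure (h2 i (mem_univ i))
    rw [mem_ofPred_eq, hWdef, interaction_congr_of_mem hcl, div_le_iff₀ (by positivity)]
    exact le_of_lt h1
  have hgpos : ∀ ε, groundEnergy U Λ < ε → 0 < g ε⁻¹ := by
    intro ε hε
    obtain ⟨a, ha, hN⟩ := hlow ε hε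
    exact ha.trans_le (ge_of_tendsto (hg _ (inv_nonneg.2 (hge.trans hε.le))) hN)
  have hganti : ∀ β β', 0 ≤ β → β ≤ β' → g β' ≤ g β := fun β β' hβ hββ' =>
    le_of_tendsto_of_tendsto' (hg β' (hβ.trans hββ')) (hg β hβ)
      fun N => hW.kineticNorm_anti (normLeb Λ) hβ hββ' N
  have hgcont : ContinuousOn g (Ici 0) := by
    refine (LipschitzOnWith.of_le_add_mul C.toNNReal fun β hβ β' hβ' => ?_).continuousOn
    rw [Real.coe_toNNReal C hW.const_nonneg]
    have hC := hW.const_nonneg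
    rcases le_total β β' with h | h
    · refine le_of_tendsto_of_tendsto (hg β hβ) ((hg β' hβ').add_const _) ?_
      filter_upwards [eventually_ge_atTop 2] with N hN
      rw [dist_comm, Real.dist_eq, abs_of_nonneg (sub_nonneg.2 h)]
      exact hW.kineticNorm_le_add (normLeb Λ) hβ h hN
    · exact (hganti β' β hβ' h).trans (le_add_of_nonneg_right (mul_nonneg hC dist_nonneg))
  refine ⟨fun ε => 3 / 2 * Real.log (g ε⁻¹), fun ε hε => ?_, ?_, ?_⟩
  · obtain ⟨a, ha, hN⟩ := hlow ε hε
    have hlim : Tendsto (fun N : ℕ => (3 / 2 - 1 / (N : ℝ)) *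
        Real.log (kineticNorm (normLeb Λ) W ε⁻¹ N)) atTop
        (nhds ((3 / 2 - 0) * Real.log (g ε⁻¹))) :=
      (tendsto_const_nhds.sub tendsto_one_div_atTop_nhds_zero_nat).mul
        ((hg _ (inv_nonneg.2 (hge.trans hε.le))).log (hgpos ε hε).ne')
    rw [sub_zero] at hlim
    refine hlim.congr' ?_
    filter_upwards [hN, eventually_ge_atTop 2] with N h1 h2
    exact (log_integral_eq_log_kineticNorm hΛne hΛopen hΛbdd hW ε h2 (ha.trans_le h1)).symm
  · refine continuousOn_const.mul (ContinuousOn.log ?_ fun ε hε => (hgpos ε hε).ne')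
    refine hgcont.comp (continuousOn_id.inv₀ fun ε hε => (hge.trans_lt hε).ne') fun ε hε => ?_
    exact inv_nonneg.2 (hge.trans (le_of_lt hε))
  · intro ε hε ε' hε' h
    have h0 : 0 < ε := hge.trans_lt hε
    refine mul_le_mul_of_nonneg_left (Real.log_le_log (hgpos ε hε) ?_) (by norm_num)
    exact hganti _ _ (inv_nonneg.2 (h0.le.trans h)) (inv_anti₀ h0 h)
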